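/- arXiv:2602.05768 — 4 statements merged into one kernel-verified Lean document; each statement's English description precedes it below -/
import Mathlib

section
/- Let W ⊆ ℚ^r be a linear subspace of dimension d with d < r. If the orthogonal complement W^⊥ contains no nonzero vector supported on at most two coordinates, then the number of vectors of W all of whose coordinates lie in {0,1} satisfies |W ∩ {0,1}^r| ≤ (3/4) · 2^d. -/
/-- If a rational weight function has two nonzero values, then at most three quarters of all
subsets have total weight `0` or `1`. -/
theorem four_mul_card_sum_zero_or_one_le {κ : Type*} [Fintype κ] [DecidableEq κ] (c : κ → ℚ)
    {b₁ b₂ : κ} (hne : b₁ ≠ b₂) (h₁ : c b₁ ≠ 0) (h₂ : c b₂ ≠ 0) :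
    4 * (Finset.univ.filter fun S : Finset κ => ∑ b ∈ S, c b = 0 ∨ ∑ b ∈ S, c b = 1).card
      ≤ 3 * 2 ^ Fintype.card κ := by
  set p : Finset κ → Prop := fun S => ∑ b ∈ S, c b = 0 ∨ ∑ b ∈ S, c b = 1 with hp
  have hpart := Finset.card_filter_add_card_filter_not (s := Finset.univ) p
  rw [Finset.card_univ, Fintype.card_finset] at hpart
  have hbad : ∀ S : Finset κ, ∃ P ⊆ ({b₁, b₂} : Finset κ), ¬ p (S \ {b₁, b₂} ∪ P) := by
    intro S
    by_contra! hall
    have hsum : ∀ P ⊆ ({b₁, b₂} : Finset κ), ∑ b ∈ S \ {b₁, b₂} ∪ P, c b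
        = ∑ b ∈ S \ {b₁, b₂}, c b + ∑ b ∈ P, c b := fun P hP =>
      Finset.sum_union (Finset.disjoint_of_subset_right hP Finset.sdiff_disjoint)
    have e₀ := hall ∅ (by simp)
    have e₁ := hall {b₁} (by simp)
    have e₂ := hall {b₂} (by simp)
    have e₃ := hall {b₁, b₂} subset_rfl
    simp only [hp] at e₀ e₁ e₂ e₃
    rw [hsum _ (by simp)] at e₀ e₁ e₂ e₃
    rw [Finset.sum_pair hne] at e₃
    simp only [Finset.sum_singleton, Finset.sum_empty] at e₀ e₁ e₂
    grind
  have hcover : (Finset.univ : Finset (Finset κ)) ⊆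
      ((Finset.univ.filter fun S => ¬ p S) ×ˢ ({b₁, b₂} : Finset κ).powerset).image
        fun z => z.1 \ {b₁, b₂} ∪ z.2 := by
    intro S _
    obtain ⟨P, hP, hbadP⟩ := hbad S
    refine Finset.mem_image.2 ⟨(S \ {b₁, b₂} ∪ P, S ∩ {b₁, b₂}), by simp [hbadP], ?_⟩
    simp only
    ext x
    have := @hP x
    simp only [Finset.mem_union, Finset.mem_sdiff, Finset.mem_inter]
    tauto
  have hcard := (Finset.card_le_card hcover).trans Finset.card_image_le
  rw [Finset.card_product, Finset.card_powerset, Finset.card_pair hne, Finset.card_univ,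
    Fintype.card_finset] at hcard
  lia

/-- If no nonzero vector orthogonal to `W` is supported on at most two coordinates, then writing
a coordinate on `W` as a combination of other coordinates needs two nonzero coefficients. -/
theorem exists_pair_ne_zero_of_eq_sum {ι κ : Type*} [Fintype ι] [DecidableEq ι] [Fintype κ]
    (W : Submodule ℚ (ι → ℚ))
    (hperp : ∀ y : ι → ℚ, (∀ x ∈ W, ∑ i, y i * x i = 0) →
      (Finset.univ.filter fun i => y i ≠ 0).card ≤ 2 → y = 0)
    (a : κ → ι) {j : ι} (hj : ∀ b, a b ≠ j) (c : κ → ℚ)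
    (hc : ∀ x ∈ W, x j = ∑ b, c b * x (a b)) :
    ∃ b₁, c b₁ ≠ 0 ∧ ∃ b₂, c b₂ ≠ 0 ∧ b₁ ≠ b₂ := by
  by_contra! hone
  let y : ι → ℚ := Pi.single j 1 - ∑ b, c b • Pi.single (a b) 1
  have hyj : y j = 1 := by
    simp [y, Finset.sum_apply, fun b => (hj b).symm]
  have hy0 : y = 0 := by
    apply hperp
    · intro x hx
      have : ∑ i, y i * x i = y ⬝ᵥ x := rfl
      rw [this]
      simp [y, sub_dotProduct, sum_dotProduct, hc x hx]
    · have hsub : (Finset.univ.filter fun i => y i ≠ 0) ⊆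
          insert j ((Finset.univ.filter fun b => c b ≠ 0).image a) := by
        intro i hi
        simp only [Finset.mem_filter, Finset.mem_univ, true_and] at hi
        by_contra hni
        simp only [Finset.mem_insert, Finset.mem_image, Finset.mem_filter, Finset.mem_univ,
          true_and, not_or, not_exists, not_and] at hni
        apply hi
        simp only [y, Pi.sub_apply, Finset.sum_apply, Pi.smul_apply, smul_eq_mul,
          Pi.single_apply, if_neg hni.1, zero_sub, neg_eq_zero]
        refine Finset.sum_eq_zero fun b _ => ?_
        by_cases hb : c b = 0
        · simp [hb]
        · simp [Ne.symm (hni.2 b hb)]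
      have hle : (Finset.univ.filter fun b => c b ≠ 0).card ≤ 1 :=
        Finset.card_le_one.2 fun p hp q hq =>
          hone p (Finset.mem_filter.1 hp).2 q (Finset.mem_filter.1 hq).2
      have := Finset.card_le_card hsub
      have := Finset.card_insert_le j ((Finset.univ.filter fun b => c b ≠ 0).image a)
      have := Finset.card_image_le (s := Finset.univ.filter fun b => c b ≠ 0) (f := a)
      lia
  rw [hy0] at hyj
  simp at hyj

/-- Let `W ⊆ ℚ^r` be a `d`-dimensional subspace with `d < r`.
If `W^⊥` contains no nonzero vector supported on at most two coordinates, then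
`|W ∩ {0,1}^r| ≤ (3/4)·2^d`. -/
theorem stmt_6 (r d : ℕ) (hdr : d < r) (W : Submodule ℚ (Fin r → ℚ))
    (hdim : Module.finrank ℚ W = d)
    (hperp : ∀ y : Fin r → ℚ, (∀ x ∈ W, ∑ i, y i * x i = 0) →
      (Finset.univ.filter fun i => y i ≠ 0).card ≤ 2 → y = 0) :
    (Nat.card {x : Fin r → ℚ // x ∈ W ∧ ∀ i, x i = 0 ∨ x i = 1} : ℝ)
      ≤ (3 / 4 : ℝ) * 2 ^ d := by
  classical
  let v : Fin r → Module.Dual ℚ W := fun i => LinearMap.proj i ∘ₗ W.subtype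
  obtain ⟨κ, a, ha, hspan, hind⟩ := exists_linearIndependent' ℚ v
  have : Finite κ := Finite.of_injective a ha
  have := Fintype.ofFinite κ
  have hκ : Fintype.card κ ≤ d := by
    rw [← hdim, ← Subspace.dual_finrank_eq]
    exact hind.fintype_card_le_finrank
  have hcoord : ∀ i, ∃ c : κ → ℚ, ∀ x ∈ W, x i = ∑ b, c b * x (a b) := by
    intro i
    have hi : v i ∈ Submodule.span ℚ (Set.range (v ∘ a)) :=
      hspan ▸ Submodule.subset_span ⟨i, rfl⟩
    obtain ⟨c, hc⟩ := (Submodule.mem_span_range_iff_exists_fun ℚ).1 hi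
    refine ⟨c, fun x hx => ?_⟩
    have := LinearMap.congr_fun hc ⟨x, hx⟩
    simpa [v] using this.symm
  obtain ⟨j, hj⟩ : ∃ j, ∀ b, a b ≠ j := by
    by_contra! hsurj
    have := Fintype.card_le_of_surjective a hsurj
    rw [Fintype.card_fin] at this
    lia
  obtain ⟨c, hc⟩ := hcoord j
  obtain ⟨b₁, h₁, b₂, h₂, hne⟩ : ∃ b₁, c b₁ ≠ 0 ∧ ∃ b₂, c b₂ ≠ 0 ∧ b₁ ≠ b₂ :=
    exists_pair_ne_zero_of_eq_sum W hperp a hj c hc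
  let A : Finset (Finset κ) :=
    Finset.univ.filter fun S : Finset κ => ∑ b ∈ S, c b = 0 ∨ ∑ b ∈ S, c b = 1
  let F : {x : Fin r → ℚ // x ∈ W ∧ ∀ i, x i = 0 ∨ x i = 1} → A := fun x =>
    ⟨Finset.univ.filter fun b => x.1 (a b) = 1, by
      have hsum : ∑ b with x.1 (a b) = 1, c b = x.1 j := by
        rw [hc x.1 x.2.1, Finset.sum_filter]
        refine Finset.sum_congr rfl fun b _ => ?_
        rcases x.2.2 (a b) with h | h <;> simp [h]
      simpa [A, hsum] using x.2.2 j⟩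
  have hF : Function.Injective F := by
    intro x z hxz
    have hS := congrArg Subtype.val hxz
    have hab : ∀ b, x.1 (a b) = z.1 (a b) := by
      intro b
      have hb : x.1 (a b) = 1 ↔ z.1 (a b) = 1 := by
        simpa [F] using Finset.ext_iff.1 hS b
      rcases x.2.2 (a b) with h | h
      · rcases z.2.2 (a b) with h' | h'
        · rw [h, h']
        · rw [h', hb.2 h']
      · rw [h, hb.1 h]
    refine Subtype.ext (funext fun i => ?_)
    obtain ⟨e, he⟩ := hcoord i
    rw [he _ x.2.1, he _ z.2.1]
    simp only [hab]
  have hcard := Nat.card_le_card_of_injective F hF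
  rw [Nat.card_eq_fintype_card (α := A), Fintype.card_coe] at hcard
  have hA : 4 * A.card ≤ 3 * 2 ^ Fintype.card κ := four_mul_card_sum_zero_or_one_le c hne h₁ h₂
  have hpow : 2 ^ Fintype.card κ ≤ 2 ^ d := Nat.pow_le_pow_right two_pos hκ
  have hfinal : 4 * Nat.card {x : Fin r → ℚ // x ∈ W ∧ ∀ i, x i = 0 ∨ x i = 1} ≤ 3 * 2 ^ d := by
    lia
  have : (4 : ℝ) * Nat.card {x : Fin r → ℚ // x ∈ W ∧ ∀ i, x i = 0 ∨ x i = 1} ≤ 3 * 2 ^ d := by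
    exact_mod_cast hfinal
  linarith
end

section
/- Let d ≥ 2 and let L(u) = ∑_{ℓ=1}^d α_ℓ u_ℓ be a linear form on ℚ^d with rational coefficients such that at least two of the coefficients α_ℓ are nonzero. Then the number of vectors u ∈ {0,1}^d with L(u) ∈ {0,1} is at most (3/4) · 2^d. -/
/-- The value of the linear form with coefficients `α` at a Boolean vector. -/
def boolForm {ι : Type*} [Fintype ι] (α : ι → ℚ) (v : ι → Bool) : ℚ :=
  ∑ k, if v k then α k else 0

lemma boolForm_update_true {ι : Type*} [Fintype ι] [DecidableEq ι] (α : ι → ℚ) (v : ι → Bool)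
    (j : ι) :
    boolForm α (Function.update v j true) = boolForm α (Function.update v j false) + α j := by
  unfold boolForm
  rw [← Finset.add_sum_erase _ _ (Finset.mem_univ j),
    ← Finset.add_sum_erase (a := j) _ (fun k => if Function.update v j false k then α k else 0)
      (Finset.mem_univ j)]
  have h : ∀ p, ∑ k ∈ Finset.univ.erase j, (if Function.update v j p k then α k else 0)
      = ∑ k ∈ Finset.univ.erase j, (if v k then α k else 0) := fun p =>
    Finset.sum_congr rfl fun k hk => by rw [Function.update_of_ne (Finset.ne_of_mem_erase hk)]
  rw [h, h]
  simp [add_comm]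

/-- Every Boolean vector can be changed in two coordinates with nonzero coefficients so that
the form takes a value outside `{0, 1}`. -/
lemma exists_boolForm_notMem {ι : Type*} [Fintype ι] (α : ι → ℚ) {i j : ι}
    (hij : i ≠ j) (hi : α i ≠ 0) (hj : α j ≠ 0) (v : ι → Bool) :
    ∃ w : ι → Bool, ¬ (boolForm α w = 0 ∨ boolForm α w = 1) ∧
      ∀ k, k ≠ i → k ≠ j → w k = v k := by
  classical
  by_contra! H
  have good (p q : Bool) :
      boolForm α (Function.update (Function.update v i p) j q) = 0 ∨
        boolForm α (Function.update (Function.update v i p) j q) = 1 := by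
    by_contra hbad
    obtain ⟨k, hki, hkj, hk⟩ := H _ (not_or.mp hbad)
    simp [hki, hkj] at hk
  have h₁ := boolForm_update_true α (Function.update v i false) j
  have h₂ := boolForm_update_true α (Function.update v i true) j
  have h₃ := boolForm_update_true α (Function.update v j false) i
  rw [Function.update_comm hij.symm, Function.update_comm hij.symm] at h₃
  have g₀ := good false false
  have g₁ := good false true
  have g₂ := good true false
  have g₃ := good true true
  grind

lemma card_boolForm_mem_le {ι : Type*} [Fintype ι] (α : ι → ℚ) {i j : ι}
    (hij : i ≠ j) (hi : α i ≠ 0) (hj : α j ≠ 0) :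
    4 * Nat.card {v : ι → Bool // boolForm α v = 0 ∨ boolForm α v = 1}
      ≤ 3 * 2 ^ Fintype.card ι := by
  classical
  choose w hw hwv using exists_boolForm_notMem α hij hi hj
  let f : (ι → Bool) → {v : ι → Bool // ¬ (boolForm α v = 0 ∨ boolForm α v = 1)} × Bool × Bool :=
    fun v => (⟨w v, hw v⟩, v i, v j)
  have hf : Function.Injective f := by
    intro v v' h
    simp only [f, Prod.mk.injEq, Subtype.mk.injEq] at h
    obtain ⟨h, h_i, h_j⟩ := h
    funext k
    by_cases hki : k = i
    · rw [hki, h_i]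
    by_cases hkj : k = j
    · rw [hkj, h_j]
    rw [← hwv v k hki hkj, h, hwv v' k hki hkj]
  have hle := Fintype.card_le_of_injective f hf
  have hcompl := Fintype.card_subtype_compl
    (fun v : ι → Bool => boolForm α v = 0 ∨ boolForm α v = 1)
  have hsub := Fintype.card_subtype_le
    (fun v : ι → Bool => boolForm α v = 0 ∨ boolForm α v = 1)
  rw [Fintype.card_prod, hcompl] at hle
  simp only [Fintype.card_prod, Fintype.card_bool, Fintype.card_fun] at hle hsub
  rw [Nat.card_eq_fintype_card]
  omega


/-- Let `d ≥ 2` and `L(u) = ∑ α_ℓ u_ℓ` be a rational linear form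
on `ℚ^d` with at least two nonzero coefficients. Then the number of `u ∈ {0,1}^d`
with `L(u) ∈ {0,1}` is at most `(3/4)·2^d`. -/
theorem stmt_7 (d : ℕ) (hd : 2 ≤ d) (α : Fin d → ℚ)
    (hα : ∃ i j : Fin d, i ≠ j ∧ α i ≠ 0 ∧ α j ≠ 0) :
    (Nat.card {u : Fin d → ℚ // (∀ i, u i = 0 ∨ u i = 1) ∧
        ((∑ i, α i * u i) = 0 ∨ (∑ i, α i * u i) = 1)} : ℝ)
      ≤ (3 / 4 : ℝ) * 2 ^ d := by
  obtain ⟨i, j, hij, hi, hj⟩ := hα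
  have hcard := card_boolForm_mem_le α hij hi hj
  have hform (u : Fin d → ℚ) (hu : ∀ i, u i = 0 ∨ u i = 1) :
      boolForm α (fun k => decide (u k = 1)) = ∑ k, α k * u k :=
    Finset.sum_congr rfl fun k _ => by rcases hu k with h | h <;> simp [h]
  have hle : Nat.card {u : Fin d → ℚ // (∀ i, u i = 0 ∨ u i = 1) ∧
        ((∑ i, α i * u i) = 0 ∨ (∑ i, α i * u i) = 1)} ≤
      Nat.card {v : Fin d → Bool // boolForm α v = 0 ∨ boolForm α v = 1} := by
    refine Nat.card_le_card_of_injective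
      (fun u => ⟨fun k => decide (u.1 k = 1), by rw [hform u.1 u.2.1]; exact u.2.2⟩) ?_
    rintro ⟨u, hu, _⟩ ⟨u', hu', _⟩ h
    simp only [Subtype.mk.injEq] at h ⊢
    funext k
    have hk := congrFun h k
    rcases hu k with h | h <;> rcases hu' k with h' | h' <;> simp_all
  rw [Fintype.card_fin] at hcard
  have hmul : (4 : ℝ) * (Nat.card {u : Fin d → ℚ // (∀ i, u i = 0 ∨ u i = 1) ∧
        ((∑ i, α i * u i) = 0 ∨ (∑ i, α i * u i) = 1)} : ℝ) ≤ 3 * 2 ^ d := by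
    exact_mod_cast (Nat.mul_le_mul_left 4 hle).trans hcard
  linarith
end

section
/- Let k, r, d be positive integers with d < r. The number of ordered r-tuples (S_1, …, S_r) of pairwise distinct nonempty subsets of {1,…,k} whose r × k incidence matrix V (with V_{j,t} = 1 iff t ∈ S_j) has rank exactly d over ℚ is at most 2^{r²} · ((3/4) · 2^d)^k. -/
open Finset Module Submodule

/-- If a linear form `a` on `σ → ℚ` is neither zero nor a coordinate form, then it takes a value
in `{0, 1}` on at most three quarters of the vertices of the cube `{0, 1}^σ`. -/
theorem four_mul_card_sum_eq_zero_or_one_le {σ : Type*} [Fintype σ] [DecidableEq σ] (a : σ → ℚ)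
    (h0 : a ≠ 0) (h1 : ∀ i, a ≠ Pi.single i 1) :
    4 * #{T : Finset σ | ∑ i ∈ T, a i = 0 ∨ ∑ i ∈ T, a i = 1} ≤ 3 * 2 ^ Fintype.card σ := by
  obtain ⟨i, hi⟩ := Function.ne_iff.mp h0
  rw [Pi.zero_apply] at hi
  by_cases h : ∃ j, j ≠ i ∧ a j ≠ 0
  · obtain ⟨j, hji, hj⟩ := h
    set A : Finset (Finset σ) := {T | ∑ i ∈ T, a i = 0 ∨ ∑ i ∈ T, a i = 1} with hA
    have hcard : #({i, j}ᶜ : Finset σ) + 2 = Fintype.card σ := by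
      rw [← card_pair hji.symm, card_compl_add_card]
    have key : #A ≤ 3 * #(({i, j}ᶜ : Finset σ).powerset) := by
      refine card_le_mul_card_image_of_maps_to (f := fun T => T \ {i, j}) ?_ 3 ?_
      · intro T _
        simp only [mem_powerset]
        intro x hx
        simpa using (mem_sdiff.mp hx).2
      · intro R hR
        rw [mem_powerset] at hR
        have hiR : i ∉ R := fun h => by simpa using hR h
        have hjR : j ∉ R := fun h => by simpa using hR h
        have hijR : i ∉ insert j R := by simp [hji.symm, hiR]
        have hsub : ({T ∈ A | T \ {i, j} = R} : Finset (Finset σ)) ⊆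
            {R, insert i R, insert j R, insert i (insert j R)} := by
          intro T hT
          obtain ⟨-, rfl⟩ := mem_filter.mp hT
          simp only [mem_insert, mem_singleton]
          by_cases hiT : i ∈ T <;> by_cases hjT : j ∈ T
          · right; right; right; ext x; by_cases x = i <;> by_cases x = j <;> simp_all
          · right; left; ext x; by_cases x = i <;> by_cases x = j <;> simp_all
          · right; right; left; ext x; by_cases x = i <;> by_cases x = j <;> simp_all
          · left; ext x; by_cases x = i <;> by_cases x = j <;> simp_all
        have hbad : ∃ T ∈ ({R, insert i R, insert j R, insert i (insert j R)} :
            Finset (Finset σ)), T ∉ A := by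
          by_contra! hall
          have e0 := hall R (by simp)
          have e1 := hall (insert i R) (by simp)
          have e2 := hall (insert j R) (by simp)
          have e3 := hall (insert i (insert j R)) (by simp)
          simp only [hA, mem_filter, mem_univ, true_and, sum_insert hiR, sum_insert hjR,
            sum_insert hijR] at e0 e1 e2 e3
          grind
        obtain ⟨T, hT, hTA⟩ := hbad
        have hlt : #{T ∈ A | T \ {i, j} = R} <
            #({R, insert i R, insert j R, insert i (insert j R)} : Finset (Finset σ)) :=
          card_lt_card (hsub.ssubset_of_mem_notMem hT fun h => hTA (mem_filter.mp h).1)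
        have hfour := card_le_four (a := R) (b := insert i R) (c := insert j R)
          (d := insert i (insert j R))
        lia
    rw [card_powerset] at key
    rw [← hcard, pow_add]
    lia
  · push Not at h
    have hi1 : a i ≠ 1 := by
      intro hi1
      refine h1 i (funext fun j => ?_)
      by_cases hj : j = i
      · subst hj; simp [hi1]
      · simp [hj, h j hj]
    have hsub : ({T | ∑ i ∈ T, a i = 0 ∨ ∑ i ∈ T, a i = 1} : Finset (Finset σ)) ⊆
        ({i}ᶜ : Finset σ).powerset := by
      intro T hT
      rw [mem_powerset, subset_compl_singleton]
      intro hiT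
      rw [mem_filter, sum_eq_single_of_mem i hiT fun j _ hj => h j hj] at hT
      tauto
    have hle := card_le_card hsub
    have hcard : #({i}ᶜ : Finset σ) + 1 = Fintype.card σ := by
      rw [← card_singleton i, card_compl_add_card]
    rw [card_powerset] at hle
    rw [← hcard, pow_succ]
    lia

/-- The `0/1` indicator vector of a finite set. -/
def indicatorVec {ι : Type*} [DecidableEq ι] (T : Finset ι) : ι → ℚ :=
  fun j => if j ∈ T then 1 else 0

/-- A proper subspace of `ℚ^ι` on which the coordinate forms are nonzero and pairwise distinct
contains at most `(3/4) * 2 ^ dim` vectors with entries in `{0, 1}`. -/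
theorem four_mul_card_indicatorVec_mem_le {ι : Type*} [Fintype ι] [DecidableEq ι]
    (U : Submodule ℚ (ι → ℚ)) [DecidablePred fun T : Finset ι => indicatorVec T ∈ U]
    (hU : finrank ℚ U < Fintype.card ι)
    (h0 : ∀ j, ∃ x ∈ U, x j ≠ 0) (h1 : ∀ i j, i ≠ j → ∃ x ∈ U, x i ≠ x j) :
    4 * #{T : Finset ι | indicatorVec T ∈ U} ≤ 3 * 2 ^ finrank ℚ U := by
  classical
  let φ : ι → Dual ℚ U := fun j => (LinearMap.proj j).comp U.subtype
  obtain ⟨s, -, -, hspan, hind⟩ := exists_linearIndepOn_extension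
    (linearIndepOn_empty ℚ φ) (Set.subset_univ _)
  have hcoeff (j : ι) : ∃ a : s → ℚ, ∀ x ∈ U, ∑ i, a i * x i = x j := by
    have hj := hspan (Set.mem_image_of_mem φ (Set.mem_univ j))
    rw [Set.image_eq_range, SetLike.mem_coe, mem_span_range_iff_exists_fun] at hj
    obtain ⟨a, ha⟩ := hj
    refine ⟨a, fun x hx => ?_⟩
    simpa [φ] using LinearMap.congr_fun ha ⟨x, hx⟩
  have hs : Fintype.card s ≤ finrank ℚ U := by
    rw [← Subspace.dual_finrank_eq]
    exact hind.fintype_card_le_finrank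
  obtain ⟨j, hj⟩ : ∃ j, j ∉ s := by
    by_contra! h
    obtain rfl : s = Set.univ := Set.eq_univ_of_forall h
    rw [Fintype.card_setUniv] at hs
    lia
  obtain ⟨a, ha⟩ := hcoeff j
  have ha0 : a ≠ 0 := by
    rintro rfl
    obtain ⟨x, hx, hxj⟩ := h0 j
    exact hxj (by simpa using (ha x hx).symm)
  have ha1 (i : s) : a ≠ Pi.single i 1 := by
    rintro rfl
    obtain ⟨x, hx, hxj⟩ := h1 i j (fun h => hj (h ▸ i.2))
    exact hxj (by simpa [Pi.single_apply] using ha x hx)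
  have hle : #{T : Finset ι | indicatorVec T ∈ U} ≤
      #{R : Finset s | ∑ i ∈ R, a i = 0 ∨ ∑ i ∈ R, a i = 1} := by
    refine card_le_card_of_injOn (fun T => ({i : s | (i : ι) ∈ T} : Finset s)) ?_ ?_
    · intro T hT
      have hT' := ha _ (by simpa using hT)
      simp only [indicatorVec, mul_ite, mul_one, mul_zero] at hT'
      simp only [coe_filter, mem_univ, true_and, Set.mem_ofPred_eq, sum_filter]
      rw [hT']
      split_ifs <;> simp
    · intro T hT T' hT' hTT
      ext i
      obtain ⟨b, hb⟩ := hcoeff i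
      have e := hb _ (by simpa using hT)
      have e' := hb _ (by simpa using hT')
      have hmem (l : s) : indicatorVec T l = indicatorVec T' l := by
        have := Finset.ext_iff.mp hTT l
        simp only [mem_filter, mem_univ, true_and] at this
        simp [indicatorVec, this]
      simp only [hmem] at e
      have := e.symm.trans e'
      simp only [indicatorVec] at this
      split_ifs at this <;> simp_all
  calc _ ≤ _ := Nat.mul_le_mul_left 4 hle
    _ ≤ _ := four_mul_card_sum_eq_zero_or_one_le a ha0 ha1
    _ ≤ _ := Nat.mul_le_mul_left 3 (Nat.pow_le_pow_right two_pos hs)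

/-- A set spanning a nonzero space of dimension at most `r` contains a family of `r` vectors,
possibly with repetitions, with the same span. -/
theorem exists_fun_fin_span_eq {K M : Type*} [Field K] [AddCommGroup M] [Module K M]
    (s : Set M) {r : ℕ} (hpos : 0 < finrank K (span K s)) (hr : finrank K (span K s) ≤ r) :
    ∃ f : Fin r → M, (∀ i, f i ∈ s) ∧ span K (Set.range f) = span K s := by
  have := finite_of_finrank_pos hpos
  obtain ⟨f, hf, hspan, -⟩ := exists_fun_fin_finrank_span_eq K s
  have : Nonempty (Fin (finrank K (span K s))) := ⟨⟨0, hpos⟩⟩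
  have hsurj := Function.invFun_surjective (Fin.castLE_injective hr)
  exact ⟨f ∘ Function.invFun (Fin.castLE hr), fun i => hf _, by rw [hsurj.range_comp, hspan]⟩

/-- The set of indices `j` with `t ∈ S j`, i.e. the column of the incidence matrix at `t`. -/
def incidenceCol {ι κ : Type*} [Fintype ι] [DecidableEq κ] (S : ι → Finset κ) (t : κ) :
    Finset ι :=
  {j | t ∈ S j}

theorem incidenceCol_injective {ι κ : Type*} [Fintype ι] [DecidableEq κ] :
    Function.Injective (incidenceCol : (ι → Finset κ) → κ → Finset ι) := by
  intro S S' h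
  ext j t
  simpa [incidenceCol] using Finset.ext_iff.mp (congrFun h t) j

/-- The column space of the incidence matrix of `S`. -/
def incidenceSpan {ι κ : Type*} [Fintype ι] [DecidableEq ι] [DecidableEq κ]
    (S : ι → Finset κ) : Submodule ℚ (ι → ℚ) :=
  span ℚ (Set.range fun t => indicatorVec (incidenceCol S t))

theorem indicatorVec_incidenceCol_mem {ι κ : Type*} [Fintype ι] [DecidableEq ι] [DecidableEq κ]
    (S : ι → Finset κ) (t : κ) : indicatorVec (incidenceCol S t) ∈ incidenceSpan S :=
  subset_span ⟨t, rfl⟩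

theorem rank_incidence_eq_finrank {ι κ : Type*} [Fintype ι] [DecidableEq ι] [Fintype κ]
    [DecidableEq κ] (S : ι → Finset κ) :
    (Matrix.of fun j t => if t ∈ S j then (1 : ℚ) else 0).rank =
      finrank ℚ (incidenceSpan S) := by
  have h : (Matrix.of fun j t => if t ∈ S j then (1 : ℚ) else 0).col =
      fun t => indicatorVec (incidenceCol S t) := by
    ext t j
    simp [indicatorVec, incidenceCol]
  rw [Matrix.rank_eq_finrank_span_cols, h, incidenceSpan]

/-- The column space of the incidence matrix of a family of distinct nonempty sets contains at
most `(3/4) * 2 ^ dim` vectors with entries in `{0, 1}`, unless it is the whole space. -/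
theorem four_mul_card_indicatorVec_mem_incidenceSpan_le {ι κ : Type*} [Fintype ι]
    [DecidableEq ι] [DecidableEq κ] (S : ι → Finset κ)
    [DecidablePred fun T : Finset ι => indicatorVec T ∈ incidenceSpan S]
    (hinj : Function.Injective S) (hne : ∀ j, (S j).Nonempty)
    (hlt : finrank ℚ (incidenceSpan S) < Fintype.card ι) :
    4 * #{T : Finset ι | indicatorVec T ∈ incidenceSpan S} ≤
      3 * 2 ^ finrank ℚ (incidenceSpan S) := by
  refine four_mul_card_indicatorVec_mem_le _ hlt (fun j => ?_) (fun i j hij => ?_)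
  · obtain ⟨t, ht⟩ := hne j
    exact ⟨_, indicatorVec_incidenceCol_mem S t, by simp [indicatorVec, incidenceCol, ht]⟩
  · by_contra! h
    refine hij (hinj (Finset.ext fun t => ?_))
    have := h _ (indicatorVec_incidenceCol_mem S t)
    simp only [indicatorVec, incidenceCol, mem_filter, mem_univ, true_and] at this
    split_ifs at this <;> simp_all

/-- Let `k, r, d` be positive integers with `d < r`. The number of
ordered `r`-tuples `(S_1,…,S_r)` of pairwise distinct nonempty subsets of `{1,…,k}`
whose `r × k` incidence matrix has rank exactly `d` over `ℚ` is at most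
`2^{r²}·((3/4)·2^d)^k`. -/
theorem stmt_11 (k r d : ℕ) (hk : 0 < k) (hr : 0 < r) (hd : 0 < d) (hdr : d < r) :
    (Nat.card {S : Fin r → Finset (Fin k) //
        Function.Injective S ∧ (∀ j, (S j).Nonempty) ∧
        (Matrix.of fun j t => if t ∈ S j then (1 : ℚ) else 0).rank = d} : ℝ)
      ≤ 2 ^ (r ^ 2) * ((3 / 4 : ℝ) * 2 ^ d) ^ k := by
  classical
  let P : Finset (Fin r → Finset (Fin k)) :=
    {S | Function.Injective S ∧ (∀ j, (S j).Nonempty) ∧ finrank ℚ (incidenceSpan S) = d}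
  have hP : Nat.card {S : Fin r → Finset (Fin k) //
        Function.Injective S ∧ (∀ j, (S j).Nonempty) ∧
        (Matrix.of fun j t => if t ∈ S j then (1 : ℚ) else 0).rank = d} = #P := by
    simp only [rank_incidence_eq_finrank]
    rw [Nat.card_eq_fintype_card, Fintype.card_subtype]
  have hspan (S : Fin r → Finset (Fin k)) : ∃ B : Fin r → Finset (Fin r), S ∈ P →
      span ℚ (Set.range fun i => indicatorVec (B i)) = incidenceSpan S := by
    by_cases hS : S ∈ P
    · obtain ⟨-, -, -, hrank⟩ := mem_filter.mp hS
      obtain ⟨f, hf, hfs⟩ := exists_fun_fin_span_eq (K := ℚ) (r := r)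
        (Set.range fun t => indicatorVec (incidenceCol S t))
        (hd.trans_eq hrank.symm) (hrank.trans_le hdr.le)
      choose g hg using hf
      exact ⟨fun i => incidenceCol S (g i), fun _ => by simpa only [hg, incidenceSpan] using hfs⟩
    · exact ⟨fun _ => ∅, fun h => absurd h hS⟩
  choose B hB using hspan
  have hcount : #P ≤ (3 * 2 ^ d / 4) ^ k * #(univ : Finset (Fin r → Finset (Fin r))) := by
    refine card_le_mul_card_image_of_maps_to (f := B) (fun _ _ => mem_univ _) _ fun b _ => ?_
    obtain hempty | ⟨S₀, hS₀⟩ := ({S ∈ P | B S = b} : Finset _).eq_empty_or_nonempty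
    · simp [hempty]
    obtain ⟨hS₀P, rfl⟩ := mem_filter.mp hS₀
    obtain ⟨-, hinj, hne, hrank⟩ := mem_filter.mp hS₀P
    have hfour := four_mul_card_indicatorVec_mem_incidenceSpan_le S₀ hinj hne
      (by rwa [hrank, Fintype.card_fin])
    rw [hrank] at hfour
    calc #{S ∈ P | B S = B S₀}
        ≤ #(Fintype.piFinset fun _ : Fin k =>
            ({T : Finset (Fin r) | indicatorVec T ∈ incidenceSpan S₀} : Finset _)) := by
          refine card_le_card_of_injOn incidenceCol ?_ incidenceCol_injective.injOn
          intro S hS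
          obtain ⟨hSP, hSB⟩ := mem_filter.mp hS
          simp only [mem_coe, Fintype.mem_piFinset, mem_filter, mem_univ, true_and]
          intro t
          rw [← hB S₀ hS₀P, ← hSB, hB S hSP]
          exact indicatorVec_incidenceCol_mem S t
      _ = #{T : Finset (Fin r) | indicatorVec T ∈ incidenceSpan S₀} ^ k := by simp
      _ ≤ _ := Nat.pow_le_pow_left (by lia) k
  have hcard : #(univ : Finset (Fin r → Finset (Fin r))) = 2 ^ (r ^ 2) := by
    simp [← pow_mul, sq]
  rw [hcard] at hcount
  rw [hP]
  calc (#P : ℝ) ≤ (((3 * 2 ^ d / 4) ^ k * 2 ^ (r ^ 2) : ℕ) : ℝ) := by exact_mod_cast hcount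
    _ = 2 ^ (r ^ 2) * ((3 * 2 ^ d / 4 : ℕ) : ℝ) ^ k := by push_cast; ring
    _ ≤ _ := by
      gcongr
      refine Nat.cast_div_le.trans_eq ?_
      push_cast
      ring
end

section
/- Let p be a prime and let k be a positive integer with k ≤ p. For every property F of finite subsets of ℤ/pℤ, the difference between the probability that a uniformly random k-element subset of ℤ/pℤ satisfies F and the probability that the set of values {a_1,…,a_k} of an i.i.d. uniform tuple a ∈ (ℤ/pℤ)^k satisfies F is at most k(k−1)/p in absolute value; that is, | #{A ⊆ ℤ/pℤ : |A| = k, F(A)} / C(p,k) − #{a ∈ (ℤ/pℤ)^k : F({a_1,…,a_k})} / p^k | ≤ k(k−1)/p. -/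
open Finset in
/-- A `k`-element finset is the image of exactly `k!` injective `k`-tuples. -/
theorem card_injective_image_eq {α : Type*} [Fintype α] [DecidableEq α] {k : ℕ} {A : Finset α}
    (hA : #A = k) :
    #{a : Fin k → α | Function.Injective a ∧ univ.image a = A} = k.factorial := by
  have hcard : Fintype.card (Fin k ≃ A) = k.factorial := by
    rw [Fintype.card_equiv (Fintype.equivOfCardEq (by simp [hA])), Fintype.card_fin]
  rw [← hcard, ← card_univ]
  symm
  refine card_bij (fun e _ i => (e i : α)) ?_ ?_ ?_
  · intro e _
    simp only [mem_filter, mem_univ, true_and]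
    refine ⟨Subtype.val_injective.comp e.injective, ?_⟩
    ext x
    simp only [mem_image, mem_univ, true_and]
    constructor
    · rintro ⟨i, rfl⟩
      exact (e i).2
    · intro hx
      exact ⟨e.symm ⟨x, hx⟩, by simp⟩
  · intro e _ e' _ h
    ext i
    exact congrFun h i
  · intro a ha
    simp only [mem_filter, mem_univ, true_and] at ha
    obtain ⟨hinj, rfl⟩ := ha
    refine ⟨Equiv.ofBijective (fun i => ⟨a i, mem_image_of_mem a (mem_univ i)⟩) ⟨?_, ?_⟩,
      mem_univ _, rfl⟩
    · intro i j h
      exact hinj (congrArg Subtype.val h)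
    · rintro ⟨x, hx⟩
      obtain ⟨i, -, rfl⟩ := mem_image.1 hx
      exact ⟨i, rfl⟩

open Finset in
/-- Injective `k`-tuples whose set of values satisfies `F` are `k!` times as many as the
`k`-element finsets satisfying `F`. -/
theorem card_injective_image {α : Type*} [Fintype α] [DecidableEq α] (k : ℕ)
    (F : Finset α → Prop) [DecidablePred F] :
    #{a : Fin k → α | Function.Injective a ∧ F (univ.image a)}
      = #{A : Finset α | #A = k ∧ F A} * k.factorial := by
  rw [card_eq_sum_card_fiberwise (f := fun a => univ.image a)
    (t := ({A : Finset α | #A = k ∧ F A} : Finset (Finset α)))]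
  · refine sum_const_nat fun A hA => ?_
    simp only [mem_filter, mem_univ, true_and] at hA
    rw [← card_injective_image_eq hA.1, filter_filter]
    congr 1
    ext a
    simp only [mem_filter, mem_univ, true_and]
    constructor
    · rintro ⟨⟨h, -⟩, h'⟩
      exact ⟨h, h'⟩
    · rintro ⟨h, h'⟩
      exact ⟨⟨h, h' ▸ hA.2⟩, h'⟩
  · intro a ha
    simp only [coe_filter, mem_univ, true_and, Set.mem_ofPred_eq] at ha ⊢
    exact ⟨by rw [card_image_of_injective _ ha.1, card_fin], ha.2⟩

open Finset in
/-- The number of injective `k`-tuples is a falling factorial. -/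
theorem card_injective_tuples (α : Type*) [Fintype α] [DecidableEq α] (k : ℕ) :
    #{a : Fin k → α | Function.Injective a} = (Fintype.card α).descFactorial k := by
  have h := card_injective_image (α := α) k (fun _ => True)
  simp only [and_true] at h
  rw [h, Nat.descFactorial_eq_factorial_mul_choose, mul_comm]
  congr 1
  rw [← card_univ, ← card_powersetCard]
  congr 1
  ext A
  simp [mem_powersetCard]

/-- The birthday bound: a random `k`-tuple from `n` elements has a repetition with probability
at most `k (k - 1) / n`. -/
theorem one_sub_le_descFactorial_div_pow {n k : ℕ} (hn : 0 < n) (hk : k ≤ n) :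
    1 - (k : ℝ) * ((k : ℝ) - 1) / n ≤ (n.descFactorial k : ℝ) / (n : ℝ) ^ k := by
  have hn' : (0 : ℝ) < n := by exact_mod_cast hn
  induction k with
  | zero => simp
  | succ k ih =>
    have ih := ih (by omega)
    have hq : (n.descFactorial k : ℝ) / (n : ℝ) ^ k ≤ 1 := by
      rw [div_le_one (by positivity)]
      exact_mod_cast Nat.descFactorial_le_pow n k
    have hstep : (n.descFactorial (k + 1) : ℝ) / (n : ℝ) ^ (k + 1)
        = (1 - (k : ℝ) / n) * ((n.descFactorial k : ℝ) / (n : ℝ) ^ k) := by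
      rw [Nat.descFactorial_succ, Nat.cast_mul, Nat.cast_sub (by omega)]
      field_simp
      ring
    have hkn : (0 : ℝ) ≤ (k : ℝ) / n := by positivity
    have hexp : ((k + 1 : ℕ) : ℝ) * (((k + 1 : ℕ) : ℝ) - 1) / n
        = (k : ℝ) * ((k : ℝ) - 1) / n + 2 * ((k : ℝ) / n) := by
      push_cast
      ring
    rw [hstep, hexp]
    nlinarith [mul_le_mul_of_nonneg_left hq hkn]


/-- Let `p` be prime and `1 ≤ k ≤ p`. For every property `F` of
finite subsets of `ℤ/pℤ`, the probability (in the uniform `k`-subset model) that `F`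
holds and the probability (in the i.i.d. model, applied to the set of values of the
tuple) that `F` holds differ by at most `k(k−1)/p`. -/
theorem stmt_13 (p : ℕ) (hp : p.Prime) (k : ℕ) (hk : 0 < k) (hkp : k ≤ p)
    (F : Finset (ZMod p) → Prop) :
    |(Nat.card {A : Finset (ZMod p) // A.card = k ∧ F A} : ℝ) / (p.choose k : ℝ)
        - (Nat.card {a : Fin k → ZMod p // F (Finset.image a Finset.univ)} : ℝ)
            / (p : ℝ) ^ k|
      ≤ (k : ℝ) * ((k : ℝ) - 1) / (p : ℝ) := by
  classical
  have : NeZero p := ⟨hp.ne_zero⟩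
  have hp0 : 0 < p := hp.pos
  rw [Nat.card_eq_fintype_card, Nat.card_eq_fintype_card, Fintype.card_subtype,
    Fintype.card_subtype]
  have hI := card_injective_image (α := ZMod p) k F
  have hD := card_injective_tuples (ZMod p) k
  rw [ZMod.card] at hD
  have hbirth := one_sub_le_descFactorial_div_pow hp0 hkp
  set N := Finset.card {A : Finset (ZMod p) | A.card = k ∧ F A}
  set T := Finset.card {a : Fin k → ZMod p | F (Finset.image a Finset.univ)}
  set I := Finset.card {a : Fin k → ZMod p |
    Function.Injective a ∧ F (Finset.image a Finset.univ)}
  have hIT : I ≤ T := Finset.card_le_card fun a => by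
    simp only [Finset.mem_filter, Finset.mem_univ, true_and]
    exact And.right
  have hID : I ≤ p.descFactorial k := hD ▸ Finset.card_le_card fun a => by
    simp only [Finset.mem_filter, Finset.mem_univ, true_and]
    exact And.left
  have hTI : T + p.descFactorial k ≤ I + p ^ k := by
    have hunion := Finset.card_union_add_card_inter
      ({a : Fin k → ZMod p | F (Finset.image a Finset.univ)} : Finset (Fin k → ZMod p))
      ({a : Fin k → ZMod p | Function.Injective a} : Finset (Fin k → ZMod p))
    rw [hD, ← Finset.filter_and] at hunion
    simp only [and_comm (b := Function.Injective _)] at hunion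
    have hle := Finset.card_le_univ
      (({a : Fin k → ZMod p | F (Finset.image a Finset.univ)} : Finset (Fin k → ZMod p)) ∪
      ({a : Fin k → ZMod p | Function.Injective a} : Finset (Fin k → ZMod p)))
    rw [Fintype.card_fun, ZMod.card, Fintype.card_fin] at hle
    omega
  have hDpos : (0 : ℝ) < p.descFactorial k := by
    exact_mod_cast Nat.descFactorial_pos.2 hkp
  have hPpos : (0 : ℝ) < (p : ℝ) ^ k := by positivity
  have hx : (N : ℝ) / p.choose k = (I : ℝ) / p.descFactorial k := by
    rw [hI, Nat.descFactorial_eq_factorial_mul_choose]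
    push_cast
    rw [mul_comm (k.factorial : ℝ), mul_div_mul_right _ _ (by positivity)]
  have hx0 : (0 : ℝ) ≤ (I : ℝ) / p.descFactorial k := by positivity
  have hx1 : (I : ℝ) / p.descFactorial k ≤ 1 := by
    rw [div_le_one hDpos]
    exact_mod_cast hID
  have hq1 : (p.descFactorial k : ℝ) / (p : ℝ) ^ k ≤ 1 := by
    rw [div_le_one hPpos]
    exact_mod_cast Nat.descFactorial_le_pow p k
  have hxq : (I : ℝ) / (p : ℝ) ^ k
      = (I : ℝ) / p.descFactorial k * ((p.descFactorial k : ℝ) / (p : ℝ) ^ k) := by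
    field_simp
  have hlow : (I : ℝ) / (p : ℝ) ^ k ≤ (T : ℝ) / (p : ℝ) ^ k := by gcongr
  have hupp : (T : ℝ) / (p : ℝ) ^ k + (p.descFactorial k : ℝ) / (p : ℝ) ^ k
      ≤ (I : ℝ) / (p : ℝ) ^ k + 1 := by
    rw [← add_div, ← div_self hPpos.ne', ← add_div, div_le_div_iff_of_pos_right hPpos]
    exact_mod_cast hTI
  rw [hx, abs_le]
  constructor
  · nlinarith [mul_nonneg hx0 (sub_nonneg.2 hq1)]
  · nlinarith [mul_nonneg (sub_nonneg.2 hx1) (sub_nonneg.2 hq1)]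
end
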